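/- Let T be a positive integer, σ > 0, Δ > 0 and ε ≥ 0 real numbers, and let m = (m₁, …, m_T) ∈ ℝ^T with Euclidean norm ‖m‖₂ ≤ Δ. Let P = ⊗_{t=1}^{T} N(0, σ²) and Q = ⊗_{t=1}^{T} N(m_t, σ²) be the corresponding product Gaussian measures on ℝ^T, let Φ be the standard normal CDF, and set δ = Φ(−ε·σ/Δ + Δ/(2σ)) − e^ε·Φ(−ε·σ/Δ − Δ/(2σ)). Then for every Borel set A ⊆ ℝ^T, P(A) ≤ e^ε·Q(A) + δ. -/

import Mathlib

open MeasureTheory ProbabilityTheory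

/-- The standard normal cumulative distribution function. -/
noncomputable def stdNormalCDF (x : ℝ) : ℝ :=
  (gaussianReal 0 1 (Set.Iic x)).toReal

open scoped NNReal ENNReal

/-- A product of measures with densities has the product density. -/
theorem pi_withDensity_eq_withDensity_prod {ι : Type*} [Fintype ι] {X : ι → Type*}
    [∀ i, MeasurableSpace (X i)] (μ : ∀ i, Measure (X i)) [∀ i, IsProbabilityMeasure (μ i)]
    (f : ∀ i, X i → ℝ≥0∞) (hf : ∀ i, Measurable (f i))
    [∀ i, SigmaFinite ((μ i).withDensity (f i))] :
    Measure.pi (fun i => (μ i).withDensity (f i)) =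
      (Measure.pi μ).withDensity (fun x => ∏ i, f i (x i)) := by
  classical
  refine Measure.pi_eq fun s hs => ?_
  have hg (i : ι) : Measurable ((s i).indicator (f i)) := (hf i).indicator (hs i)
  have hind : (Set.univ.pi s).indicator (fun x => ∏ i, f i (x i)) =
      fun x => ∏ i, (s i).indicator (f i) (x i) := by
    ext x
    by_cases hx : ∀ i, x i ∈ s i
    · simp [Set.indicator, hx]
    · obtain ⟨i, hi⟩ := not_forall.mp hx
      rw [Set.indicator_of_notMem (by simpa using hx),
        Finset.prod_eq_zero (Finset.mem_univ i) (Set.indicator_of_notMem hi _)]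
  rw [withDensity_apply _ (MeasurableSet.univ_pi hs),
    ← lintegral_indicator (MeasurableSet.univ_pi hs), hind,
    lintegral_prod_eq_prod_lintegral_of_indepFun Finset.univ
      (fun i (x : ∀ i, X i) => (s i).indicator (f i) (x i))
      (iIndepFun_pi fun i => (hg i).aemeasurable)
      (fun i => (hg i).comp (measurable_pi_apply i))]
  refine Finset.prod_congr rfl fun i _ => ?_
  rw [(measurePreserving_eval μ i).lintegral_comp (hg i), lintegral_indicator (hs i),
    withDensity_apply _ (hs i)]

/-- The likelihood ratio of two Gaussian measures with the same variance. -/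
theorem gaussianReal_eq_withDensity_gaussianReal_zero (m : ℝ) {v : ℝ≥0} (hv : v ≠ 0) :
    gaussianReal m v = (gaussianReal 0 v).withDensity
      (fun x => ENNReal.ofReal (Real.exp ((m * x - m ^ 2 / 2) / v))) := by
  rw [gaussianReal_of_var_ne_zero _ hv, gaussianReal_of_var_ne_zero _ hv,
    ← withDensity_mul _ (measurable_gaussianPDF _ _) (by fun_prop)]
  congr 1
  ext x
  have hv' : (v : ℝ) ≠ 0 := by exact_mod_cast hv
  rw [Pi.mul_apply, gaussianPDF, gaussianPDF, ← ENNReal.ofReal_mul (gaussianPDFReal_nonneg _ _ _),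
    gaussianPDFReal, gaussianPDFReal, mul_assoc (√_)⁻¹, ← Real.exp_add]
  congr 3
  field_simp
  ring

/-- The likelihood ratio of two product Gaussian measures with the same variance. -/
theorem pi_gaussianReal_eq_withDensity {ι : Type*} [Fintype ι] (m : ι → ℝ) {v : ℝ≥0}
    (hv : v ≠ 0) :
    Measure.pi (fun i => gaussianReal (m i) v) =
      (Measure.pi fun _ : ι => gaussianReal 0 v).withDensity
        (fun x => ENNReal.ofReal
          (Real.exp ((∑ i, m i * x i - (∑ i, m i ^ 2) / 2) / v))) := by
  have h (i : ι) := gaussianReal_eq_withDensity_gaussianReal_zero (m i) hv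
  have (i : ι) : SigmaFinite ((gaussianReal 0 v).withDensity
      (fun x => ENNReal.ofReal (Real.exp ((m i * x - m i ^ 2 / 2) / v)))) := by
    rw [← h]; infer_instance
  simp_rw [h]
  rw [pi_withDensity_eq_withDensity_prod _ _ (fun i => by fun_prop)]
  congr 1
  ext x
  rw [← ENNReal.ofReal_prod_of_nonneg (fun _ _ => (Real.exp_pos _).le), ← Real.exp_sum,
    ← Finset.sum_div, Finset.sum_sub_distrib, Finset.sum_div]

/-- A linear form of independent Gaussian variables of variance `v` is Gaussian. -/
theorem map_sum_mul_pi_gaussianReal {ι : Type*} [Fintype ι] (a m : ι → ℝ) (v : ℝ≥0) :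
    (Measure.pi fun i => gaussianReal (a i) v).map (fun x => ∑ i, m i * x i) =
      gaussianReal (∑ i, m i * a i) ((∑ i, m i ^ 2).toNNReal * v) := by
  have : IsProbabilityMeasure
      ((Measure.pi fun i => gaussianReal (a i) v).map (fun x => ∑ i, m i * x i)) :=
    Measure.isProbabilityMeasure_map (Measurable.aemeasurable (by fun_prop))
  refine Measure.ext_of_charFun ?_
  rw [iIndepFun.charFun_map_fun_sum_eq_prod (X := fun i (x : ι → ℝ) => m i * x i)
    (fun i => Measurable.aemeasurable (by fun_prop))
    (iIndepFun_pi (X := fun i (y : ℝ) => m i * y) fun i => by fun_prop)]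
  have hmap (i : ι) : (Measure.pi fun i => gaussianReal (a i) v).map (fun x => m i * x i) =
      gaussianReal (m i * a i) (.mk (m i ^ 2) (sq_nonneg _) * v) := by
    rw [← gaussianReal_map_const_mul,
      ← (measurePreserving_eval (fun i => gaussianReal (a i) v) i).map_eq,
      Measure.map_map (by fun_prop) (by fun_prop)]
    rfl
  ext t
  simp_rw [hmap, Finset.prod_apply, charFun_gaussianReal, ← Complex.exp_sum]
  congr 1
  rw [NNReal.coe_mul, Real.coe_toNNReal _ (Finset.sum_nonneg fun i _ => sq_nonneg _)]
  push_cast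
  rw [Finset.sum_sub_distrib, Finset.mul_sum, Finset.sum_mul, Finset.sum_mul, Finset.sum_mul,
    Finset.sum_div]

/-- The distribution function of a Gaussian measure in terms of the standard normal one. -/
theorem gaussianReal_Iic_eq_stdNormalCDF (μ : ℝ) {s : ℝ} (hs : 0 < s) (c : ℝ) :
    gaussianReal μ (s ^ 2).toNNReal (Set.Iic c) =
      ENNReal.ofReal (stdNormalCDF ((c - μ) / s)) := by
  have hmap : gaussianReal μ (s ^ 2).toNNReal =
      (gaussianReal 0 1).map (fun x => s * x + μ) := by
    have h : (gaussianReal 0 1).map (fun x => s * x + μ) =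
        ((gaussianReal 0 1).map (s * ·)).map (· + μ) := by
      rw [Measure.map_map (by fun_prop) (by fun_prop)]
      rfl
    rw [h, gaussianReal_map_const_mul, gaussianReal_map_add_const]
    congr 1
    · simp
    · rw [mul_one]
      exact Real.toNNReal_of_nonneg (sq_nonneg s)
  rw [stdNormalCDF, ENNReal.ofReal_toReal (measure_ne_top _ _), hmap,
    Measure.map_apply (by fun_prop) measurableSet_Iic]
  congr 1
  ext x
  rw [Set.mem_preimage, Set.mem_Iic, Set.mem_Iic, le_div_iff₀ hs, mul_comm, le_sub_iff_add_le]

/-- The Neyman-Pearson lemma: the set where the density `g` of `μ.withDensity g` satisfies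
`c * g ≤ 1` maximises `μ A - c * μ.withDensity g A`. -/
theorem measure_add_le_of_withDensity {X : Type*} [MeasurableSpace X] (μ : Measure X)
    {g : X → ℝ≥0∞} (hg : Measurable g) (c : ℝ≥0∞) {A : Set X} (hA : MeasurableSet A) :
    μ A + c * μ.withDensity g {x | c * g x ≤ 1} ≤
      c * μ.withDensity g A + μ {x | c * g x ≤ 1} := by
  set B := {x | c * g x ≤ 1}
  have hB : MeasurableSet B := measurableSet_le (by fun_prop) measurable_const
  have hc {S : Set X} (hS : MeasurableSet S) :
      c * μ.withDensity g S = ∫⁻ x in S, c * g x ∂μ := by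
    rw [withDensity_apply _ hS, lintegral_const_mul _ hg]
  have hle : c * μ.withDensity g (B \ A) ≤ μ (B \ A) := by
    rw [hc (hB.diff hA), ← setLIntegral_one]
    exact setLIntegral_mono measurable_const fun x hx => hx.1
  have hge : μ (A \ B) ≤ c * μ.withDensity g (A \ B) := by
    rw [hc (hA.diff hB), ← setLIntegral_one]
    exact setLIntegral_mono (by fun_prop) fun x hx => (not_le.mp hx.2).le
  calc μ A + c * μ.withDensity g B
      = (μ (A ∩ B) + c * μ.withDensity g (A ∩ B)) +
          (μ (A \ B) + c * μ.withDensity g (B \ A)) := by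
        rw [← measure_inter_add_sdiff A hB, ← measure_inter_add_sdiff B hA, Set.inter_comm B A]
        ring
    _ ≤ (μ (A ∩ B) + c * μ.withDensity g (A ∩ B)) +
          (c * μ.withDensity g (A \ B) + μ (B \ A)) := by gcongr
    _ = c * μ.withDensity g A + μ B := by
        rw [← measure_inter_add_sdiff A hB, ← measure_inter_add_sdiff B hA, Set.inter_comm B A]
        ring

/-- The trade-off of two product Gaussian measures whose means are at distance exactly `Δ`. -/
theorem pi_gaussianReal_le_of_sum_sq_eq {ι : Type*} [Fintype ι] {σ Δ : ℝ} (hσ : 0 < σ)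
    (hΔ : 0 < Δ) (ε : ℝ) (m : ι → ℝ) (hm : ∑ i, m i ^ 2 = Δ ^ 2) {A : Set (ι → ℝ)}
    (hA : MeasurableSet A) :
    Measure.pi (fun _ : ι => gaussianReal 0 (σ ^ 2).toNNReal) A ≤
      ENNReal.ofReal (Real.exp ε) *
          Measure.pi (fun i => gaussianReal (m i) (σ ^ 2).toNNReal) A +
        ENNReal.ofReal (stdNormalCDF (-(ε * σ) / Δ + Δ / (2 * σ)) -
          Real.exp ε * stdNormalCDF (-(ε * σ) / Δ - Δ / (2 * σ))) := by
  have hv : (σ ^ 2).toNNReal ≠ 0 := by simpa using hσ.ne'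
  have hvar : (Δ ^ 2).toNNReal * (σ ^ 2).toNNReal = ((Δ * σ) ^ 2).toNNReal := by
    rw [← Real.toNNReal_mul (sq_nonneg _), mul_pow]
  have hNP := measure_add_le_of_withDensity
    (Measure.pi fun _ : ι => gaussianReal 0 (σ ^ 2).toNNReal)
    (g := fun x => ENNReal.ofReal
      (Real.exp ((∑ i, m i * x i - (∑ i, m i ^ 2) / 2) / (σ ^ 2).toNNReal)))
    (by fun_prop) (ENNReal.ofReal (Real.exp ε)) hA
  rw [← pi_gaussianReal_eq_withDensity m hv] at hNP
  have hset : {x : ι → ℝ | ENNReal.ofReal (Real.exp ε) * ENNReal.ofReal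
      (Real.exp ((∑ i, m i * x i - (∑ i, m i ^ 2) / 2) / (σ ^ 2).toNNReal)) ≤ 1} =
      (fun x => ∑ i, m i * x i) ⁻¹' Set.Iic (Δ ^ 2 / 2 - ε * σ ^ 2) := by
    ext x
    rw [Set.mem_ofPred_eq, ← ENNReal.ofReal_mul (Real.exp_pos _).le, ← Real.exp_add,
      ENNReal.ofReal_le_one, Real.exp_le_one_iff, hm, Real.coe_toNNReal _ (sq_nonneg _),
      ← le_neg_iff_add_nonpos_right, ← neg_div, le_div_iff₀ (by positivity), Set.mem_preimage,
      Set.mem_Iic]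
    constructor <;> intro h <;> linarith
  have hprob (a : ι → ℝ) : Measure.pi (fun i => gaussianReal (a i) (σ ^ 2).toNNReal)
      ((fun x => ∑ i, m i * x i) ⁻¹' Set.Iic (Δ ^ 2 / 2 - ε * σ ^ 2)) =
      ENNReal.ofReal (stdNormalCDF ((Δ ^ 2 / 2 - ε * σ ^ 2 - ∑ i, m i * a i) / (Δ * σ))) := by
    rw [← Measure.map_apply (by fun_prop) measurableSet_Iic, map_sum_mul_pi_gaussianReal, hm, hvar,
      gaussianReal_Iic_eq_stdNormalCDF _ (by positivity)]
  have hsum : ∑ i, m i * m i = Δ ^ 2 := by simp_rw [← hm, sq]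
  have hP : (Δ ^ 2 / 2 - ε * σ ^ 2 - ∑ i, m i * (0 : ℝ)) / (Δ * σ) =
      -(ε * σ) / Δ + Δ / (2 * σ) := by
    simp only [mul_zero, Finset.sum_const_zero]
    field_simp
    ring
  have hQ : (Δ ^ 2 / 2 - ε * σ ^ 2 - ∑ i, m i * m i) / (Δ * σ) =
      -(ε * σ) / Δ - Δ / (2 * σ) := by
    rw [hsum]
    field_simp
    ring
  rw [hset, hprob m, hprob fun _ => 0, hP, hQ, ← ENNReal.ofReal_mul (Real.exp_pos _).le] at hNP
  have hnonneg : 0 ≤ Real.exp ε * stdNormalCDF (-(ε * σ) / Δ - Δ / (2 * σ)) :=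
    mul_nonneg (Real.exp_pos _).le ENNReal.toReal_nonneg
  rw [ENNReal.ofReal_sub _ hnonneg]
  refine (ENNReal.le_sub_of_add_le_right ENNReal.ofReal_ne_top hNP).trans ?_
  exact add_tsub_le_assoc

/-- Dropping the first coordinate of a product measure leaves the product of the others. -/
theorem measurePreserving_tail_pi {n : ℕ} (μ : Fin (n + 1) → Measure ℝ)
    [∀ i, IsProbabilityMeasure (μ i)] :
    MeasurePreserving (fun (x : Fin (n + 1) → ℝ) i => x (Fin.succ i)) (Measure.pi μ)
      (Measure.pi fun i => μ i.succ) :=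
  measurePreserving_snd.comp (measurePreserving_piFinSuccAbove μ 0)

/-- Composition of Gaussian mechanisms: if the mean-shift vector `m ∈ ℝ^T` has
Euclidean norm at most `Δ`, then the product Gaussian measures
`P = ⊗ N(0, σ²)` and `Q = ⊗ N(m_t, σ²)` satisfy `P(A) ≤ e^ε·Q(A) + δ` for every
Borel set `A`, where `δ = Φ(−εσ/Δ + Δ/(2σ)) − e^ε·Φ(−εσ/Δ − Δ/(2σ))`. -/
theorem gaussian_composition_dp
    (T : ℕ) (hT : 0 < T) (σ Δ ε : ℝ) (hσ : 0 < σ) (hΔ : 0 < Δ) (hε : 0 ≤ ε)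
    (m : Fin T → ℝ) (hm : Real.sqrt (∑ t, (m t) ^ 2) ≤ Δ)
    (P Q : Measure (Fin T → ℝ))
    (hP : P = Measure.pi fun _ => gaussianReal 0 (σ ^ 2).toNNReal)
    (hQ : Q = Measure.pi fun t => gaussianReal (m t) (σ ^ 2).toNNReal)
    (δ : ℝ)
    (hδ : δ = stdNormalCDF (-(ε * σ) / Δ + Δ / (2 * σ)) -
        Real.exp ε * stdNormalCDF (-(ε * σ) / Δ - Δ / (2 * σ))) :
    ∀ A : Set (Fin T → ℝ), MeasurableSet A →
      P A ≤ ENNReal.ofReal (Real.exp ε) * Q A + ENNReal.ofReal δ := by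
  intro A hA
  subst hP hQ hδ
  have hm' : ∑ t, m t ^ 2 ≤ Δ ^ 2 := (Real.sqrt_le_left hΔ.le).mp hm
  let m' : Fin (T + 1) → ℝ := Fin.cons (Real.sqrt (Δ ^ 2 - ∑ t, m t ^ 2)) m
  have hsum : ∑ i, m' i ^ 2 = Δ ^ 2 := by
    simp [m', Fin.sum_univ_succ, Real.sq_sqrt (sub_nonneg.mpr hm')]
  have hP := measurePreserving_tail_pi fun _ : Fin (T + 1) => gaussianReal 0 (σ ^ 2).toNNReal
  have hQ := measurePreserving_tail_pi fun i => gaussianReal (m' i) (σ ^ 2).toNNReal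
  have h := pi_gaussianReal_le_of_sum_sq_eq hσ hΔ ε m' hsum (hP.measurable hA)
  rw [hP.measure_preimage hA.nullMeasurableSet, hQ.measure_preimage hA.nullMeasurableSet] at h
  simpa only [m', Fin.cons_succ] using h
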